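/- If P is a (B+1)-partition of G with value at least v*, then for every j ∈ Fin n all s j clique vertices with first coordinate j lie in a single part of P. -/

import Mathlib

open scoped Classical

set_option linter.unnecessarySeqFocus false

/-- Vertices of the bin-packing graph: clique vertices `(j, a)` together with
the `k` bin vertices `b_i`. -/
abbrev BPV (n k : ℕ) (s : Fin n → ℕ) := (Σ j : Fin n, Fin (s j)) ⊕ Fin k

/-- Adjacency: two clique vertices are adjacent iff they share the first
coordinate; every bin vertex is adjacent to every clique vertex; bin vertices
are pairwise non-adjacent. -/
def bpAdj (n k : ℕ) (s : Fin n → ℕ) : BPV n k s → BPV n k s → Prop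
  | Sum.inl x, Sum.inl y => x.1 = y.1 ∧ x ≠ y
  | Sum.inl _, Sum.inr _ => True
  | Sum.inr _, Sum.inl _ => True
  | Sum.inr _, Sum.inr _ => False

/-- The bin-packing graph `G`. -/
def bpGraph (n k : ℕ) (s : Fin n → ℕ) : SimpleGraph (BPV n k s) where
  Adj := bpAdj n k s
  symm := by
    constructor
    intro a b h
    cases a <;> cases b <;> simp only [bpAdj] at h ⊢ <;> try trivial
    exact ⟨h.1.symm, fun e => h.2 e.symm⟩
  loopless := by
    constructor
    intro a h
    cases a <;> simp_all [bpAdj]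

/-- The number of edges of `G` with both endpoints in `Q`. -/
noncomputable def partVal {V : Type*} [DecidableEq V] (G : SimpleGraph V)
    (Q : Finset V) : ℕ :=
  (Q.sym2.filter (fun e => e ∈ G.edgeSet)).card

/-- The (unweighted) value of a partition `P`: the number of edges of `G` with
both endpoints in a common part of `P`. -/
noncomputable def pVal {V : Type*} [Fintype V] [DecidableEq V] (G : SimpleGraph V)
    (P : Finpartition (Finset.univ : Finset V)) : ℕ :=
  ∑ Q ∈ P.parts, partVal G Q

/-- The edges of the bin-packing graph that join two clique vertices. -/
noncomputable def cliqueEdges (n k : ℕ) (s : Fin n → ℕ) : Finset (Sym2 (BPV n k s)) :=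
  Finset.univ.biUnion fun j : Fin n =>
    ((Finset.univ : Finset (Fin (s j))).offDiag.image Sym2.mk.uncurry).image
      (Sym2.map fun a => Sum.inl ⟨j, a⟩)

theorem mk_mem_cliqueEdges {n k : ℕ} {s : Fin n → ℕ} {j : Fin n} {a b : Fin (s j)}
    (h : a ≠ b) :
    s((Sum.inl ⟨j, a⟩ : BPV n k s), Sum.inl ⟨j, b⟩) ∈ cliqueEdges n k s := by
  refine Finset.mem_biUnion.2 ⟨j, Finset.mem_univ _, Finset.mem_image.2 ⟨s(a, b), ?_, rfl⟩⟩
  exact Finset.mem_image.2 ⟨(a, b), by simpa using h, rfl⟩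

theorem card_cliqueEdges_le (n k : ℕ) (s : Fin n → ℕ) :
    (cliqueEdges n k s).card ≤ ∑ j : Fin n, s j * (s j - 1) / 2 := by
  refine Finset.card_biUnion_le.trans (Finset.sum_le_sum fun j _ => ?_)
  refine Finset.card_image_le.trans ?_
  have h := Sym2.card_image_offDiag (Finset.univ : Finset (Fin (s j)))
  rw [Finset.card_univ, Fintype.card_fin, Nat.choose_two_right] at h
  exact le_of_eq (by convert h)

/-- A part of size at most `B + 1` contains at most `B` edges per bin vertex in it, besides
its clique edges. -/
theorem partVal_bpGraph_le {n k B : ℕ} {s : Fin n → ℕ} [DecidableEq (BPV n k s)]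
    (Q : Finset (BPV n k s)) (hQ : Q.card ≤ B + 1) :
    partVal (bpGraph n k s) Q ≤
      ((cliqueEdges n k s).filter fun e => ∀ v ∈ e, v ∈ Q).card + Q.toRight.card * B := by
  have hsub : Q.sym2.filter (fun e => e ∈ (bpGraph n k s).edgeSet) ⊆
      ((cliqueEdges n k s).filter fun e => ∀ v ∈ e, v ∈ Q) ∪
        (Q.toRight ×ˢ Q.toLeft).image
          (fun p => s((Sum.inl p.2 : BPV n k s), Sum.inr p.1)) := by
    intro e
    induction e with
    | _ x y =>
      intro he
      simp only [Finset.mem_filter, Finset.mk_mem_sym2_iff, SimpleGraph.mem_edgeSet] at he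
      obtain ⟨⟨hx, hy⟩, hadj⟩ := he
      rw [Finset.mem_union]
      rcases x with ⟨j, a⟩ | i <;> rcases y with ⟨j', b⟩ | i'
      · left
        obtain ⟨rfl, hne⟩ : j = j' ∧ (⟨j, a⟩ : Σ j, Fin (s j)) ≠ ⟨j', b⟩ := hadj
        refine Finset.mem_filter.2 ⟨mk_mem_cliqueEdges fun h => hne (by rw [h]), ?_⟩
        intro v hv
        rcases Sym2.mem_iff.1 hv with rfl | rfl <;> assumption
      · right
        exact Finset.mem_image.2 ⟨(i', ⟨j, a⟩), by simp [hx, hy], rfl⟩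
      · right
        exact Finset.mem_image.2 ⟨(i, ⟨j', b⟩), by simp [hx, hy], Sym2.eq_swap⟩
      · exact hadj.elim
  refine (Finset.card_le_card hsub).trans ((Finset.card_union_le _ _).trans ?_)
  refine Nat.add_le_add_left (Finset.card_image_le.trans ?_) _
  rw [Finset.card_product]
  have hcard := Q.card_toLeft_add_card_toRight
  rcases Nat.eq_zero_or_pos Q.toRight.card with h | h
  · simp [h]
  · exact Nat.mul_le_mul_left _ (by omega)

theorem sum_card_toRight_le {n k : ℕ} {s : Fin n → ℕ} [DecidableEq (BPV n k s)]
    (P : Finpartition (Finset.univ : Finset (BPV n k s))) :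
    ∑ Q ∈ P.parts, Q.toRight.card ≤ k := by
  rw [← Finset.card_biUnion]
  · exact (Finset.card_le_univ _).trans_eq (Fintype.card_fin k)
  · intro Q hQ Q' hQ' hne
    refine Finset.disjoint_left.2 fun i hi hi' => hne ?_
    exact P.eq_of_mem_parts hQ hQ' (Finset.mem_toRight.1 hi) (Finset.mem_toRight.1 hi')

/-- If an element of `E` is not contained in any part, then fewer than `E.card` elements
of `E` are. -/
theorem sum_card_filter_lt {V : Type*} [Fintype V] [DecidableEq V]
    (P : Finpartition (Finset.univ : Finset V)) (E : Finset (Sym2 V)) {e₀ : Sym2 V}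
    (he₀ : e₀ ∈ E) (hsplit : ∀ Q ∈ P.parts, ∃ v ∈ e₀, v ∉ Q) :
    ∑ Q ∈ P.parts, (E.filter fun e => ∀ v ∈ e, v ∈ Q).card < E.card := by
  rw [← Finset.card_biUnion]
  · refine Finset.card_lt_card ((Finset.ssubset_iff_of_subset ?_).2 ⟨e₀, he₀, ?_⟩)
    · exact Finset.biUnion_subset.2 fun Q _ => Finset.filter_subset _ _
    · intro h
      obtain ⟨Q, hQ, h⟩ := Finset.mem_biUnion.1 h
      obtain ⟨v, hv, hvQ⟩ := hsplit Q hQ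
      exact hvQ ((Finset.mem_filter.1 h).2 v hv)
  · intro Q hQ Q' hQ' hne
    refine Finset.disjoint_left.2 fun e he he' => hne ?_
    have hv := Sym2.out_fst_mem e
    exact P.eq_of_mem_parts hQ hQ' ((Finset.mem_filter.1 he).2 _ hv)
      ((Finset.mem_filter.1 he').2 _ hv)

/-- In any `(B+1)`-partition of value at least `v*`, for every `j` all the
clique vertices with first coordinate `j` lie in a single part. -/
theorem stmt8 (n k B : ℕ) (hn : 1 ≤ n) (hk : 1 ≤ k) (hB : 1 ≤ B)
    (s : Fin n → ℕ) (hs : ∀ j, 1 ≤ s j)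
    (P : Finpartition (Finset.univ : Finset (BPV n k s)))
    (hP : ∀ Q ∈ P.parts, Q.card ≤ B + 1)
    (hval : (∑ j : Fin n, s j * (s j - 1) / 2) + k * B ≤ pVal (bpGraph n k s) P) :
    ∀ j : Fin n, ∃ Q ∈ P.parts, ∀ a : Fin (s j),
      (Sum.inl ⟨j, a⟩ : BPV n k s) ∈ Q := by
  intro j
  let a₀ : Fin (s j) := ⟨0, hs j⟩
  obtain ⟨Q, hQ, haQ⟩ := P.exists_mem (Finset.mem_univ (Sum.inl ⟨j, a₀⟩ : BPV n k s))
  refine ⟨Q, hQ, fun a => ?_⟩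
  by_contra ha
  have hne : a₀ ≠ a := fun h => ha (h ▸ haQ)
  have hlt := sum_card_filter_lt P (cliqueEdges n k s) (mk_mem_cliqueEdges hne) (by
    intro Q' hQ'
    by_cases h : (Sum.inl ⟨j, a₀⟩ : BPV n k s) ∈ Q'
    · obtain rfl := P.eq_of_mem_parts hQ hQ' haQ h
      exact ⟨_, Sym2.mem_mk_right _ _, ha⟩
    · exact ⟨_, Sym2.mem_mk_left _ _, h⟩)
  have hle : pVal (bpGraph n k s) P ≤ _ :=
    Finset.sum_le_sum fun Q hQ => partVal_bpGraph_le Q (hP Q hQ)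
  rw [Finset.sum_add_distrib, ← Finset.sum_mul] at hle
  have hbin := Nat.mul_le_mul_right B (sum_card_toRight_le P)
  have hcard := card_cliqueEdges_le n k s
  omega
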